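/- arXiv:1801.07525 — 2 statements merged into one kernel-verified Lean document; each statement's English description precedes it below -/
import Mathlib

section
/- Let I be a real interval, n ∈ ℕ, and let f₁,…,fₙ : I → ℝ be C² functions with nowhere vanishing first derivative, with each fₖ″ locally Lipschitz and each Arrow–Pratt index fₖ″/fₖ′ bounded on I. Let a ∈ Iⁿ and suppose that no iterate M_f^k(a) is a constant vector, and that there exists m ∈ I such that every coordinate of M_f^k(a) converges to m as k → ∞. Then lim_{k→∞} Var(M_f^{k+1}(a)) / (Var(M_f^k(a)))² = Var(A_f(m))/4. -/
/-- Arithmetic mean of a finite vector of reals. -/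
noncomputable def amean {n : ℕ} (a : Fin n → ℝ) : ℝ := (∑ i, a i) / n

/-- Variance of a finite vector of reals. -/
noncomputable def varV {n : ℕ} (a : Fin n → ℝ) : ℝ := (∑ i, (a i - amean a) ^ 2) / n

/-- Spread (max - min) of a finite vector of reals. -/
noncomputable def deltaV {n : ℕ} (a : Fin n → ℝ) : ℝ := sSup (Set.range a) - sInf (Set.range a)

/-- The remainder term `R_f(a)` (Taylor remainder form). -/
noncomputable def Rf (f f' f'' : ℝ → ℝ) {n : ℕ} (a : Fin n → ℝ) : ℝ :=
  (1 / (n * f' (amean a))) *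
    ∑ i, (f (a i) - f (amean a) - f' (amean a) * (a i - amean a)
          - (1 / 2) * f'' (amean a) * (a i - amean a) ^ 2)

/-- The remainder term `S_f`, where `m` is the arithmetic mean of the vector and
`Q` is the quasi-arithmetic mean `QA_f(a)`. -/
noncomputable def Sf (f f' f'' : ℝ → ℝ) (m Q : ℝ) : ℝ :=
  ∫ u in m..Q, (f u - f Q) * f'' u / (f' u) ^ 2

/-- The star norm `‖g‖_* = sup_{p,q ∈ I} |∫_p^q g|`. -/
noncomputable def starNorm (g : ℝ → ℝ) (I : Set ℝ) : ℝ :=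
  sSup {x | ∃ p ∈ I, ∃ q ∈ I, x = |∫ t in p..q, g t|}

open Filter Asymptotics Topology

/-- A function whose derivative is `ε`-close to `c` on a convex set is, up to `ε`, affine with
slope `c` there. -/
lemma abs_sub_sub_mul_le_of_abs_deriv_sub_le {S : Set ℝ} (hS : Convex ℝ S) {f f' : ℝ → ℝ}
    {c ε : ℝ} (hf : ∀ x ∈ S, HasDerivAt f (f' x) x) (hf' : ∀ x ∈ S, |f' x - c| ≤ ε)
    {x t : ℝ} (hx : x ∈ S) (ht : t ∈ S) :
    |f x - f t - c * (x - t)| ≤ ε * |x - t| := by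
  have hg : ∀ u ∈ S, HasDerivWithinAt (fun u => f u - c * u) (f' u - c) S u := fun u hu =>
    (((hf u hu).sub ((hasDerivAt_id u).const_mul c)).congr_deriv (by simp)).hasDerivWithinAt
  have h := hS.norm_image_sub_le_of_norm_hasDerivWithin_le hg (fun u hu => hf' u hu) ht hx
  simp only [Real.norm_eq_abs] at h
  convert h using 2
  ring

/-- Second-order version of `abs_sub_sub_mul_le_of_abs_deriv_sub_le`. -/
lemma abs_taylor_two_le_of_abs_deriv_sub_le {S : Set ℝ} (hS : Convex ℝ S) {f f' f'' : ℝ → ℝ}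
    {c ε : ℝ} (hf : ∀ x ∈ S, HasDerivAt f (f' x) x) (hf' : ∀ x ∈ S, HasDerivAt f' (f'' x) x)
    (hf'' : ∀ x ∈ S, |f'' x - c| ≤ ε) {x t : ℝ} (hx : x ∈ S) (ht : t ∈ S) :
    |f x - f t - f' t * (x - t) - c / 2 * (x - t) ^ 2| ≤ ε * (x - t) ^ 2 := by
  have hε : 0 ≤ ε := (abs_nonneg _).trans (hf'' x hx)
  have hsub : Set.uIcc t x ⊆ S := hS.ordConnected.uIcc_subset ht hx
  have hg : ∀ u ∈ Set.uIcc t x,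
      HasDerivWithinAt (fun u => f u - f' t * (u - t) - c / 2 * (u - t) ^ 2)
        (f' u - f' t - c * (u - t)) (Set.uIcc t x) u := fun u hu => by
    have hid := (hasDerivAt_id u).sub_const t
    have h := ((hf u (hsub hu)).sub (hid.const_mul (f' t))).sub ((hid.pow 2).const_mul (c / 2))
    refine (h.congr_deriv ?_).hasDerivWithinAt
    simp
    ring
  have hbound : ∀ u ∈ Set.uIcc t x, ‖f' u - f' t - c * (u - t)‖ ≤ ε * |x - t| := fun u hu =>
    (abs_sub_sub_mul_le_of_abs_deriv_sub_le hS hf' hf'' (hsub hu) ht).trans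
      (mul_le_mul_of_nonneg_left (Set.abs_sub_left_of_mem_uIcc hu) hε)
  have h := (convex_uIcc t x).norm_image_sub_le_of_norm_hasDerivWithin_le hg hbound
    Set.left_mem_uIcc Set.right_mem_uIcc
  simp only [Real.norm_eq_abs] at h
  rw [mul_assoc, ← sq, sq_abs] at h
  convert h using 2
  ring

/-- A function continuous within an interval is close to its value on a convex neighbourhood. -/
lemma ContinuousWithinAt.exists_convex_abs_sub_le {I : Set ℝ} (hI : I.OrdConnected)
    {g : ℝ → ℝ} {m ε : ℝ} (hg : ContinuousWithinAt g I m) (hε : 0 < ε) :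
    ∃ S ⊆ I, Convex ℝ S ∧ S ∈ 𝓝[I] m ∧ ∀ x ∈ S, |g x - g m| ≤ ε := by
  obtain ⟨δ, hδ, h⟩ := Metric.continuousWithinAt_iff.1 hg ε hε
  exact ⟨I ∩ Metric.ball m δ, Set.inter_subset_left, hI.convex.inter (convex_ball m δ),
    inter_mem_nhdsWithin I (Metric.ball_mem_nhds m hδ), fun x hx => (h hx.1 hx.2).le⟩

lemma sum_sub_amean {n : ℕ} (hn : 0 < n) (b : Fin n → ℝ) : ∑ i, (b i - amean b) = 0 := by
  have : (n : ℝ) ≠ 0 := by positivity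
  simp only [Finset.sum_sub_distrib, Finset.sum_const, Finset.card_univ, Fintype.card_fin,
    nsmul_eq_mul, amean]
  field_simp
  ring

lemma sum_sq_sub_amean {n : ℕ} (hn : 0 < n) (b : Fin n → ℝ) :
    ∑ i, (b i - amean b) ^ 2 = n * varV b := by
  have : (n : ℝ) ≠ 0 := by positivity
  unfold varV
  field_simp

lemma varV_nonneg {n : ℕ} (b : Fin n → ℝ) : 0 ≤ varV b := by
  unfold varV
  positivity

lemma varV_ne_zero {n : ℕ} (hn : 0 < n) {b : Fin n → ℝ} (hb : ∃ i j, b i ≠ b j) :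
    varV b ≠ 0 := by
  intro h
  have hsum := sum_sq_sub_amean hn b
  rw [h, mul_zero, Finset.sum_eq_zero_iff_of_nonneg fun i _ => sq_nonneg _] at hsum
  have heq : ∀ i, b i = amean b := fun i =>
    sub_eq_zero.1 (pow_eq_zero_iff two_ne_zero |>.1 (hsum i (Finset.mem_univ i)))
  obtain ⟨i, j, hij⟩ := hb
  exact hij ((heq i).trans (heq j).symm)

lemma amean_sub_div {n : ℕ} (hn : 0 < n) (b : Fin n → ℝ) (t v : ℝ) :
    amean (fun i => (b i - t) / v) = (amean b - t) / v := by
  have : (n : ℝ) ≠ 0 := by positivity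
  simp only [amean, ← Finset.sum_div, Finset.sum_sub_distrib, Finset.sum_const,
    Finset.card_univ, Fintype.card_fin, nsmul_eq_mul]
  rw [div_right_comm, sub_div, mul_div_cancel_left₀ _ this]

lemma varV_sub_div {n : ℕ} (hn : 0 < n) (b : Fin n → ℝ) (t v : ℝ) :
    varV (fun i => (b i - t) / v) = varV b / v ^ 2 := by
  simp only [varV, amean_sub_div hn, ← sub_div, sub_sub_sub_cancel_right, div_pow,
    ← Finset.sum_div]
  rw [div_right_comm]

lemma continuous_amean {n : ℕ} : Continuous (amean : (Fin n → ℝ) → ℝ) := by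
  unfold amean
  fun_prop

lemma continuous_varV {n : ℕ} : Continuous (varV : (Fin n → ℝ) → ℝ) := by
  have := continuous_amean (n := n)
  unfold varV
  fun_prop

lemma amean_mem {n : ℕ} (hn : 0 < n) {S : Set ℝ} (hS : Convex ℝ S) {b : Fin n → ℝ}
    (hb : ∀ i, b i ∈ S) : amean b ∈ S := by
  have h0 : (n : ℝ) ≠ 0 := by positivity
  have h := hS.sum_mem (t := Finset.univ) (w := fun _ : Fin n => (n : ℝ)⁻¹) (z := b)
    (fun _ _ => by positivity) (by simp [h0]) (fun i _ => hb i)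
  rwa [← Finset.smul_sum, smul_eq_mul, inv_mul_eq_div] at h

/-- Second-order expansion of the mean of `f` over a vector around the arithmetic mean. -/
lemma abs_sum_div_sub_le {n : ℕ} (hn : 0 < n) {S : Set ℝ} (hS : Convex ℝ S)
    {f f' f'' : ℝ → ℝ} {c ε : ℝ} (hf : ∀ x ∈ S, HasDerivAt f (f' x) x)
    (hf' : ∀ x ∈ S, HasDerivAt f' (f'' x) x) (hf'' : ∀ x ∈ S, |f'' x - c| ≤ ε)
    {b : Fin n → ℝ} (hb : ∀ i, b i ∈ S) :
    |(∑ i, f (b i)) / n - f (amean b) - c / 2 * varV b| ≤ ε * varV b := by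
  have hn' : (0 : ℝ) < n := by positivity
  set t := amean b with ht
  have hsum : ∑ i, (f (b i) - f t - f' t * (b i - t) - c / 2 * (b i - t) ^ 2)
      = n * ((∑ i, f (b i)) / n - f t - c / 2 * varV b) := by
    simp only [Finset.sum_sub_distrib (f := fun i => f (b i) - f t - f' t * (b i - t)),
      Finset.sum_sub_distrib (f := fun i => f (b i) - f t),
      Finset.sum_sub_distrib (f := fun i => f (b i)), ← Finset.mul_sum]
    rw [ht, sum_sub_amean hn, sum_sq_sub_amean hn]
    simp only [Finset.sum_const, Finset.card_univ, Fintype.card_fin, nsmul_eq_mul]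
    field_simp
    ring
  have hle : |∑ i, (f (b i) - f t - f' t * (b i - t) - c / 2 * (b i - t) ^ 2)|
      ≤ n * (ε * varV b) := by
    refine (Finset.abs_sum_le_sum_abs _ _).trans ((Finset.sum_le_sum fun i _ =>
      abs_taylor_two_le_of_abs_deriv_sub_le hS hf hf' hf'' (hb i) (amean_mem hn hS hb)).trans_eq ?_)
    rw [← Finset.mul_sum, sum_sq_sub_amean hn]
    ring
  rw [hsum, abs_mul, abs_of_pos hn'] at hle
  exact le_of_mul_le_mul_left hle hn'

/-- If the vectors `b k` concentrate at `m`, then the quasi-arithmetic means `Q k` generated by `f`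
deviate from the arithmetic means by `f'' m / (2 * f' m)` times the variance, asymptotically. -/
lemma tendsto_quasiArithmetic_sub_amean_div_varV {I : Set ℝ} (hI : I.OrdConnected) {n : ℕ}
    (hn : 0 < n) {f f' f'' : ℝ → ℝ} (hf : ∀ x ∈ I, HasDerivAt f (f' x) x)
    (hf' : ∀ x ∈ I, HasDerivAt f' (f'' x) x) {m : ℝ} (hm : m ∈ I)
    (hc : ContinuousWithinAt f'' I m) (hne : f' m ≠ 0) {b : ℕ → Fin n → ℝ} {Q : ℕ → ℝ}
    (hb : ∀ i, Tendsto (fun k => b k i) atTop (𝓝[I] m)) (hQ : Tendsto Q atTop (𝓝[I] m))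
    (hfQ : ∀ k, f (Q k) = (∑ i, f (b k i)) / n) (hV : ∀ k, varV (b k) ≠ 0) :
    Tendsto (fun k => (Q k - amean (b k)) / varV (b k)) atTop (𝓝 (f'' m / f' m / 2)) := by
  have hfirst : (fun k => f (Q k) - f (amean (b k)) - f' m * (Q k - amean (b k))) =o[atTop]
      fun k => Q k - amean (b k) := by
    refine isLittleO_iff.2 fun ε hε => ?_
    obtain ⟨S, hSI, hS, hSm, hSf⟩ :=
      (hf' m hm).continuousAt.continuousWithinAt.exists_convex_abs_sub_le hI hε
    filter_upwards [eventually_all.2 fun i => hb i hSm, hQ hSm] with k hk hQk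
    exact abs_sub_sub_mul_le_of_abs_deriv_sub_le hS (fun x hx => hf x (hSI hx)) hSf hQk
      (amean_mem hn hS hk)
  have hsecond : (fun k => f (Q k) - f (amean (b k)) - f'' m / 2 * varV (b k)) =o[atTop]
      fun k => varV (b k) := by
    refine isLittleO_iff.2 fun ε hε => ?_
    obtain ⟨S, hSI, hS, hSm, hSf⟩ := hc.exists_convex_abs_sub_le hI hε
    filter_upwards [eventually_all.2 fun i => hb i hSm] with k hk
    rw [hfQ, Real.norm_of_nonneg (varV_nonneg _)]
    exact abs_sum_div_sub_le hn hS (fun x hx => hf x (hSI hx)) (fun x hx => hf' x (hSI hx)) hSf hk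
  have hequiv : (fun k => f (Q k) - f (amean (b k))) ~[atTop]
      fun k => f' m * (Q k - amean (b k)) :=
    (isLittleO_const_mul_right_iff hne).2 hfirst
  have hbig : (fun k => f (Q k) - f (amean (b k))) =O[atTop] fun k => varV (b k) := by
    simpa using hsecond.isBigO.add (isBigO_const_mul_self (f'' m / 2) (fun k => varV (b k)) atTop)
  have hdev : (fun k => Q k - amean (b k)) =O[atTop] fun k => varV (b k) :=
    ((isBigO_const_mul_left_iff hne).1 hequiv.isBigO_symm).trans hbig
  have hlim := ((hsecond.sub (hfirst.trans_isBigO hdev)).tendsto_div_nhds_zero.add_const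
    (f'' m / 2)).div_const (f' m)
  rw [zero_add, div_right_comm] at hlim
  refine hlim.congr fun k => ?_
  have := hV k
  field_simp
  ring

theorem var_ratio_tendsto_quarter_var_arrowPratt
    (I : Set ℝ) (hI : I.OrdConnected) (n : ℕ) (hn : 0 < n)
    (f f' f'' : Fin n → ℝ → ℝ)
    (hd1 : ∀ k, ∀ x ∈ I, HasDerivAt (f k) (f' k x) x)
    (hd2 : ∀ k, ∀ x ∈ I, HasDerivAt (f' k) (f'' k x) x)
    (hc : ∀ k, ContinuousOn (f'' k) I)
    (hne : ∀ k, ∀ x ∈ I, f' k x ≠ 0)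
    -- each f'' k is locally Lipschitz on I (Lipschitz on each compact subinterval of I):
    (hLip : ∀ k, ∀ p ∈ I, ∀ q ∈ I, ∃ c : ℝ,
      ∀ x ∈ Set.Icc p q, ∀ y ∈ Set.Icc p q, |f'' k x - f'' k y| ≤ c * |x - y|)
    -- each Arrow–Pratt index f'' k / f' k is bounded on I:
    (hAP : ∀ k, ∃ K : ℝ, ∀ x ∈ I, |f'' k x / f' k x| ≤ K)
    -- M is the self-map of Iⁿ whose j-th coordinate is the quasi-arithmetic mean QA_{f_j}:
    (M : (Fin n → ℝ) → (Fin n → ℝ))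
    (hM : ∀ b : Fin n → ℝ, (∀ i, b i ∈ I) →
      ∀ j, M b j ∈ I ∧ f j (M b j) = (∑ i, f j (b i)) / n)
    (a : Fin n → ℝ) (ha : ∀ i, a i ∈ I)
    -- the iteration is not degenerated: no iterate is a constant vector:
    (hnondeg : ∀ k : ℕ, ∃ i j, M^[k] a i ≠ M^[k] a j)
    -- every coordinate of the iterates converges to m ∈ I:
    (m : ℝ) (hm : m ∈ I)
    (hconv : ∀ j, Filter.Tendsto (fun k => M^[k] a j) Filter.atTop (nhds m)) :
    Filter.Tendsto (fun k => varV (M^[k + 1] a) / varV (M^[k] a) ^ 2) Filter.atTop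
      (nhds (varV (fun j => f'' j m / f' j m) / 4)) := by
  have hmem : ∀ k i, M^[k] a i ∈ I := fun k => by
    induction k with
    | zero => exact ha
    | succ k ih =>
      rw [Function.iterate_succ_apply']
      exact fun j => (hM _ ih j).1
  have hlim : ∀ j, Tendsto (fun k => M^[k] a j) atTop (𝓝[I] m) := fun j =>
    tendsto_nhdsWithin_iff.2 ⟨hconv j, Eventually.of_forall fun k => hmem k j⟩
  have hV : ∀ k, varV (M^[k] a) ≠ 0 := fun k => varV_ne_zero hn (hnondeg k)
  have hdev : ∀ j, Tendsto (fun k => (M^[k + 1] a j - amean (M^[k] a)) / varV (M^[k] a)) atTop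
      (𝓝 (f'' j m / f' j m / 2)) := fun j =>
    tendsto_quasiArithmetic_sub_amean_div_varV hI hn (hd1 j) (hd2 j) hm (hc j m hm) (hne j m hm)
      hlim ((hlim j).comp (tendsto_add_atTop_nat 1))
      (fun k => by
        simpa only [Function.comp, Function.iterate_succ_apply'] using (hM _ (hmem k) j).2) hV
  have h := (continuous_varV.tendsto _).comp (tendsto_pi_nhds.2 hdev)
  have hquarter := varV_sub_div hn (fun j => f'' j m / f' j m) 0 2
  norm_num at hquarter
  rw [hquarter] at h
  exact h.congr fun k => varV_sub_div hn _ _ _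
end

section
/- Let I be a real interval, n ∈ ℕ, and let f₁,…,fₙ : I → ℝ be C² functions with nowhere vanishing first derivative, with each fₖ″ locally Lipschitz and each Arrow–Pratt index fₖ″/fₖ′ bounded on I. Let a ∈ Iⁿ and suppose that no iterate M_f^k(a) is a constant vector, and that there exists m ∈ I such that every coordinate of M_f^k(a) converges to m as k → ∞. Then the sequence (δ(M_f^k(a)))_{k≥1} tends to zero quadratically: there exists a constant c > 0 and k₀ ∈ ℕ such that δ(M_f^{k+1}(a)) ≤ c·δ(M_f^k(a))² for all k ≥ k₀. -/
open Filter Topology Set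

lemma mem_Icc_sInf_sSup_range {n : ℕ} (b : Fin n → ℝ) (i : Fin n) :
    sInf (range b) ≤ b i ∧ b i ≤ sSup (range b) :=
  ⟨csInf_le (finite_range b).bddBelow (mem_range_self i),
    le_csSup (finite_range b).bddAbove (mem_range_self i)⟩

lemma amean_mem_Icc {n : ℕ} (hn : 0 < n) {b : Fin n → ℝ} {l u : ℝ}
    (h : ∀ i, b i ∈ Icc l u) : amean b ∈ Icc l u := by
  have hn' : (0 : ℝ) < n := by exact_mod_cast hn
  constructor
  · rw [amean, le_div_iff₀ hn']
    simpa [mul_comm] using Finset.card_nsmul_le_sum Finset.univ b l fun i _ => (h i).1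
  · rw [amean, div_le_iff₀ hn']
    simpa [mul_comm] using Finset.sum_le_card_nsmul Finset.univ b u fun i _ => (h i).2

lemma abs_sub_amean_le_deltaV {n : ℕ} (hn : 0 < n) (b : Fin n → ℝ) (i : Fin n) :
    |b i - amean b| ≤ deltaV b := by
  have hs := amean_mem_Icc hn (mem_Icc_sInf_sSup_range b)
  have hi := mem_Icc_sInf_sSup_range b i
  rw [deltaV, abs_le]
  constructor <;> linarith [hs.1, hs.2, hi.1, hi.2]

lemma deltaV_le_of_abs_sub_le {n : ℕ} (hn : 0 < n) {b : Fin n → ℝ} {s E : ℝ}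
    (h : ∀ i, |b i - s| ≤ E) : deltaV b ≤ 2 * E := by
  have hne : (range b).Nonempty := ⟨b ⟨0, hn⟩, mem_range_self _⟩
  have hsup : sSup (range b) ≤ s + E :=
    csSup_le hne (by rintro _ ⟨i, rfl⟩; linarith [(abs_le.1 (h i)).2])
  have hinf : s - E ≤ sInf (range b) :=
    le_csInf hne (by rintro _ ⟨i, rfl⟩; linarith [(abs_le.1 (h i)).1])
  rw [deltaV]
  linarith

lemma abs_taylor_one_le {J : Set ℝ} (hJ : J.OrdConnected) {f f' f'' : ℝ → ℝ} {B : ℝ}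
    (hd1 : ∀ x ∈ J, HasDerivAt f (f' x) x) (hd2 : ∀ x ∈ J, HasDerivAt f' (f'' x) x)
    (hB : ∀ x ∈ J, |f'' x| ≤ B) {s x : ℝ} (hs : s ∈ J) (hx : x ∈ J) :
    |f x - f s - f' s * (x - s)| ≤ B * |x - s| ^ 2 := by
  have hB0 : 0 ≤ B := (abs_nonneg _).trans (hB s hs)
  have hsub : uIcc s x ⊆ J := hJ.uIcc_subset hs hx
  have hf' : ∀ t ∈ uIcc s x, ‖f' t - f' s‖ ≤ B * |x - s| := by
    intro t ht
    have h := hJ.convex.norm_image_sub_le_of_norm_hasDerivWithin_le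
      (fun y hy => (hd2 y hy).hasDerivWithinAt) hB hs (hsub ht)
    refine h.trans (mul_le_mul_of_nonneg_left ?_ hB0)
    exact abs_sub_left_of_mem_uIcc ht
  have h := (convex_uIcc s x).norm_image_sub_le_of_norm_hasDerivWithin_le
    (f := fun t => f t - f' s * t) (f' := fun t => f' t - f' s)
    (fun y hy => ((hd1 y (hsub hy)).sub
      (by simpa using (hasDerivAt_id y).const_mul (f' s))).hasDerivWithinAt)
    hf' left_mem_uIcc right_mem_uIcc
  rw [Real.norm_eq_abs, Real.norm_eq_abs] at h
  calc |f x - f s - f' s * (x - s)| = |f x - f' s * x - (f s - f' s * s)| := by ring_nf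
    _ ≤ B * |x - s| * |x - s| := h
    _ = B * |x - s| ^ 2 := by ring

lemma mul_abs_sub_le_abs_image_sub {J : Set ℝ} (hJ : J.OrdConnected) {f f' : ℝ → ℝ} {d : ℝ}
    (hd1 : ∀ x ∈ J, HasDerivAt f (f' x) x) (hd : ∀ x ∈ J, d ≤ |f' x|)
    {s y : ℝ} (hs : s ∈ J) (hy : y ∈ J) : d * |y - s| ≤ |f y - f s| := by
  wlog hlt : s < y generalizing s y
  · rcases (not_lt.1 hlt).eq_or_lt with rfl | h
    · simp
    · rw [abs_sub_comm y, abs_sub_comm (f y)]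
      exact this hy hs h
  have hsub : Icc s y ⊆ J := hJ.out hs hy
  obtain ⟨c, hc, hceq⟩ := exists_hasDerivAt_eq_slope f f' hlt
    (fun t ht => (hd1 t (hsub ht)).continuousAt.continuousWithinAt)
    (fun t ht => hd1 t (hsub (Ioo_subset_Icc_self ht)))
  have hpos : y - s ≠ 0 := (sub_pos.2 hlt).ne'
  rw [← div_mul_cancel₀ (f y - f s) hpos, ← hceq, abs_mul]
  exact mul_le_mul_of_nonneg_right (hd c (hsub (Ioo_subset_Icc_self hc))) (abs_nonneg _)

lemma abs_quasiArith_sub_amean_le {J : Set ℝ} (hJ : J.OrdConnected) {f f' f'' : ℝ → ℝ}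
    {B d : ℝ} (hd0 : 0 < d)
    (hd1 : ∀ x ∈ J, HasDerivAt f (f' x) x) (hd2 : ∀ x ∈ J, HasDerivAt f' (f'' x) x)
    (hB : ∀ x ∈ J, |f'' x| ≤ B) (hd : ∀ x ∈ J, d ≤ |f' x|)
    {n : ℕ} (hn : 0 < n) {b : Fin n → ℝ} (hb : ∀ i, b i ∈ J)
    {y : ℝ} (hy : y ∈ J) (hfy : f y = (∑ i, f (b i)) / n) :
    |y - amean b| ≤ B / d * deltaV b ^ 2 := by
  have hn' : (0 : ℝ) < n := by exact_mod_cast hn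
  have hB0 : 0 ≤ B := (abs_nonneg _).trans (hB y hy)
  set s := amean b with hs_def
  have hs : s ∈ J := by
    have hne : (Finset.univ : Finset (Fin n)).Nonempty := ⟨⟨0, hn⟩, Finset.mem_univ _⟩
    obtain ⟨i, -, hi⟩ := Finset.exists_min_image Finset.univ b hne
    obtain ⟨j, -, hj⟩ := Finset.exists_max_image Finset.univ b hne
    exact hJ.out (hb i) (hb j)
      (amean_mem_Icc hn fun k => ⟨hi k (Finset.mem_univ k), hj k (Finset.mem_univ k)⟩)
  have hsum : ∑ i, (b i - s) = 0 := by
    rw [Finset.sum_sub_distrib, hs_def, amean]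
    simp
    field_simp
    ring
  have hfs : f y - f s = (∑ i, (f (b i) - f s - f' s * (b i - s))) / n := by
    rw [Finset.sum_sub_distrib, Finset.sum_sub_distrib, ← Finset.mul_sum, hsum, hfy]
    simp
    field_simp
  have hup : |f y - f s| ≤ B * deltaV b ^ 2 := by
    rw [hfs, abs_div, abs_of_pos hn', div_le_iff₀ hn']
    refine (Finset.abs_sum_le_sum_abs _ _).trans ?_
    refine (Finset.sum_le_card_nsmul Finset.univ _ (B * deltaV b ^ 2) fun i _ => ?_).trans ?_
    · refine (abs_taylor_one_le hJ hd1 hd2 hB hs (hb i)).trans ?_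
      have := abs_sub_amean_le_deltaV hn b i
      gcongr
    · simp [mul_comm]
  rw [div_mul_eq_mul_div, le_div_iff₀ hd0, mul_comm]
  exact (mul_abs_sub_le_abs_image_sub hJ hd1 hd hs hy).trans hup

theorem delta_tendsto_zero_quadratically
    (I : Set ℝ) (hI : I.OrdConnected) (n : ℕ) (hn : 0 < n)
    (f f' f'' : Fin n → ℝ → ℝ)
    (hd1 : ∀ k, ∀ x ∈ I, HasDerivAt (f k) (f' k x) x)
    (hd2 : ∀ k, ∀ x ∈ I, HasDerivAt (f' k) (f'' k x) x)
    (hc : ∀ k, ContinuousOn (f'' k) I)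
    (hne : ∀ k, ∀ x ∈ I, f' k x ≠ 0)
    -- each f'' k is locally Lipschitz on I (Lipschitz on each compact subinterval of I):
    (hLip : ∀ k, ∀ p ∈ I, ∀ q ∈ I, ∃ c : ℝ,
      ∀ x ∈ Set.Icc p q, ∀ y ∈ Set.Icc p q, |f'' k x - f'' k y| ≤ c * |x - y|)
    -- each Arrow–Pratt index f'' k / f' k is bounded on I:
    (hAP : ∀ k, ∃ K : ℝ, ∀ x ∈ I, |f'' k x / f' k x| ≤ K)
    -- M is the self-map of Iⁿ whose j-th coordinate is the quasi-arithmetic mean QA_{f_j}: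
    (M : (Fin n → ℝ) → (Fin n → ℝ))
    (hM : ∀ b : Fin n → ℝ, (∀ i, b i ∈ I) →
      ∀ j, M b j ∈ I ∧ f j (M b j) = (∑ i, f j (b i)) / n)
    (a : Fin n → ℝ) (ha : ∀ i, a i ∈ I)
    -- the iteration is not degenerated: no iterate is a constant vector:
    (hnondeg : ∀ k : ℕ, ∃ i j, M^[k] a i ≠ M^[k] a j)
    -- every coordinate of the iterates converges to m ∈ I:
    (m : ℝ) (hm : m ∈ I)
    (hconv : ∀ j, Filter.Tendsto (fun k => M^[k] a j) Filter.atTop (nhds m)) :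
    ∃ c > 0, ∃ k₀ : ℕ, ∀ k ≥ k₀, deltaV (M^[k + 1] a) ≤ c * deltaV (M^[k] a) ^ 2 := by
  have hloc : ∃ B d ε : ℝ, 0 ≤ B ∧ 0 < d ∧ 0 < ε ∧ ∀ x ∈ I ∩ Metric.ball m ε, ∀ k,
      |f'' k x| ≤ B ∧ d ≤ |f' k x| := by
    have hfin : (Finset.univ : Finset (Fin n)).Nonempty := ⟨⟨0, hn⟩, Finset.mem_univ _⟩
    obtain ⟨i, -, hi⟩ := Finset.exists_max_image Finset.univ (fun k => |f'' k m|) hfin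
    obtain ⟨j, -, hj⟩ := Finset.exists_min_image Finset.univ (fun k => |f' k m|) hfin
    have hpos : 0 < |f' j m| := abs_pos.2 (hne j m hm)
    have hev : ∀ᶠ x in 𝓝[I] m, ∀ k, |f'' k x| ≤ |f'' i m| + 1 ∧ |f' j m| / 2 ≤ |f' k x| := by
      refine eventually_all.2 fun k => ?_
      have h1 : |f'' k m| < |f'' i m| + 1 := by linarith [hi k (Finset.mem_univ k)]
      have h2 : |f' j m| / 2 < |f' k m| := by linarith [hj k (Finset.mem_univ k)]
      filter_upwards [(hc k m hm).abs.eventually_lt_const h1,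
        ((hd2 k m hm).continuousAt.continuousWithinAt (s := I)).abs.eventually_const_lt h2]
        with x hx1 hx2 using ⟨hx1.le, hx2.le⟩
    obtain ⟨ε, hε, h⟩ := Metric.mem_nhdsWithin_iff.1 hev
    exact ⟨|f'' i m| + 1, |f' j m| / 2, ε, by positivity, by positivity, hε,
      fun x hx => h ⟨hx.2, hx.1⟩⟩
  obtain ⟨B, d, ε, hB0, hd0, hε, hbd⟩ := hloc
  have hJ : (I ∩ Metric.ball m ε).OrdConnected := hI.inter (convex_ball m ε).ordConnected
  have hmem : ∀ k i, M^[k] a i ∈ I := by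
    intro k
    induction k with
    | zero => simpa using ha
    | succ k ih =>
      intro i
      rw [Function.iterate_succ_apply']
      exact (hM _ ih i).1
  have hnear : ∀ᶠ k in atTop, ∀ i, M^[k] a i ∈ Metric.ball m ε :=
    eventually_all.2 fun i => (hconv i).eventually (Metric.ball_mem_nhds m hε)
  obtain ⟨k₀, hk₀⟩ := eventually_atTop.1 hnear
  refine ⟨2 * (B / d) + 1, by positivity, k₀, fun k hk => ?_⟩
  have hstep : deltaV (M^[k + 1] a) ≤ 2 * (B / d * deltaV (M^[k] a) ^ 2) := by
    refine deltaV_le_of_abs_sub_le hn (s := amean (M^[k] a)) fun j => ?_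
    refine abs_quasiArith_sub_amean_le hJ hd0 (fun x hx => hd1 j x hx.1)
      (fun x hx => hd2 j x hx.1) (fun x hx => (hbd x hx j).1) (fun x hx => (hbd x hx j).2) hn
      (fun i => ⟨hmem k i, hk₀ k hk i⟩) ⟨hmem (k + 1) j, hk₀ (k + 1) (by omega) j⟩ ?_
    rw [Function.iterate_succ_apply']
    exact (hM _ (hmem k) j).2
  nlinarith [sq_nonneg (deltaV (M^[k] a))]
end
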